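/- Let n ≥ 3 and let i, j be distinct elements of Fin n. Consider the family of walks P_k^{(α,β)} = (a_k, b_α, a_β, b_k), indexed by triples (k, α, β) with α ≠ k, β ≠ k and α ≠ β, which route the missing edge u_k v_k of K_{n,n} through K_{n,n} − nK_2. Then the number of such triples (k, α, β) for which the walk P_k^{(α,β)} uses the edge a_i b_j — i.e., for which (k = i and α = j), or (α = j and β = i), or (k = j and β = i) — equals 3(n−2). Consequently, counting also the (n−1)(n−2) parallel copies of the edge a_i b_j itself, each edge of K_{n,n} − nK_2 carries total congestion (n−1)(n−2) + 3(n−2) = (n−2)(n+2) in the embedding of K_{n,n}^{(n−1)(n−2)} into K_{n,n} − nK_2. -/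

import Mathlib

/-- Congestion count for the embedding of `K_{n,n}^{(n−1)(n−2)}` into `K_{n,n} − nK_2`.
For `n ≥ 3` and distinct `i, j`, the number of triples `(k, α, β)` with `α ≠ k`, `β ≠ k`,
`α ≠ β` whose routing path `a_k → b_α → a_β → b_k` uses the edge `a_i b_j` — i.e. with
`(k = i ∧ α = j)`, or `(α = j ∧ β = i)`, or `(k = j ∧ β = i)` — equals `3(n−2)`;
consequently the total congestion of each edge is
`(n−1)(n−2) + 3(n−2) = (n−2)(n+2)`. -/
theorem stmt11 (n : ℕ) (h3 : 3 ≤ n) (i j : Fin n) (hij : i ≠ j) :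
    (Finset.univ.filter (fun t : Fin n × Fin n × Fin n =>
        (t.2.1 ≠ t.1 ∧ t.2.2 ≠ t.1 ∧ t.2.1 ≠ t.2.2) ∧
        ((t.1 = i ∧ t.2.1 = j) ∨ (t.2.1 = j ∧ t.2.2 = i) ∨
          (t.1 = j ∧ t.2.2 = i)))).card = 3 * (n - 2) ∧
    (n - 1) * (n - 2) + 3 * (n - 2) = (n - 2) * (n + 2) := by
  constructor
  · have hS : (({i, j} : Finset (Fin n))ᶜ).card = n - 2 := by
      rw [Finset.card_compl, Fintype.card_fin, Finset.card_pair hij]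
    have hunion : (Finset.univ.filter (fun t : Fin n × Fin n × Fin n =>
        (t.2.1 ≠ t.1 ∧ t.2.2 ≠ t.1 ∧ t.2.1 ≠ t.2.2) ∧
        ((t.1 = i ∧ t.2.1 = j) ∨ (t.2.1 = j ∧ t.2.2 = i) ∨
          (t.1 = j ∧ t.2.2 = i)))) =
        ({i, j} : Finset (Fin n))ᶜ.image (fun x => (i, j, x)) ∪
          (({i, j} : Finset (Fin n))ᶜ.image (fun x => (x, j, i)) ∪
            ({i, j} : Finset (Fin n))ᶜ.image (fun x => (j, x, i))) := by
      ext ⟨k, α, β⟩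
      simp only [Finset.mem_filter, Finset.mem_univ, true_and, Finset.mem_union,
        Finset.mem_image, Finset.mem_compl, Finset.mem_insert, Finset.mem_singleton,
        Prod.mk.injEq]
      constructor
      · rintro ⟨⟨hα, hβ, hαβ⟩, ⟨rfl, rfl⟩ | ⟨rfl, rfl⟩ | ⟨rfl, rfl⟩⟩
        · exact Or.inl ⟨β, by tauto, rfl, rfl, rfl⟩
        · exact Or.inr (Or.inl ⟨k, by tauto, rfl, rfl, rfl⟩)
        · exact Or.inr (Or.inr ⟨α, by tauto, rfl, rfl, rfl⟩)
      · rintro (⟨x, hx, rfl, rfl, rfl⟩ | ⟨x, hx, rfl, rfl, rfl⟩ | ⟨x, hx, rfl, rfl, rfl⟩) <;>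
          grind
    rw [hunion, Finset.card_union_of_disjoint, Finset.card_union_of_disjoint,
      Finset.card_image_of_injective, Finset.card_image_of_injective,
      Finset.card_image_of_injective, hS]
    · omega
    · intro x y h
      simpa using h
    · intro x y h
      simpa using h
    · intro x y h
      simpa using h
    · rw [Finset.disjoint_left]
      simp only [Finset.mem_image, Finset.mem_compl, Finset.mem_insert, Finset.mem_singleton]
      grind
    · rw [Finset.disjoint_left]
      simp only [Finset.mem_union, Finset.mem_image, Finset.mem_compl, Finset.mem_insert,
        Finset.mem_singleton]
      grind
  · obtain ⟨m, rfl⟩ := Nat.exists_eq_add_of_le h3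
    rw [show 3 + m - 1 = m + 2 by omega, show 3 + m - 2 = m + 1 by omega]
    ring
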